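/- Every 3-regular almost self-centered graph has order at least 12. -/

import Mathlib

open SimpleGraph

/-- The eccentricity of a vertex `v`: the maximum distance from `v` to any vertex. -/
noncomputable def graphEcc {V : Type*} [Fintype V] (G : SimpleGraph V) (v : V) : ℕ :=
  Finset.univ.sup fun u => G.dist v u

/-- The radius of a graph: the minimum eccentricity over all vertices. -/
noncomputable def graphRadius {V : Type*} [Fintype V] (G : SimpleGraph V) : ℕ :=
  sInf (Set.range (graphEcc G))

/-- The diameter of a graph: the maximum eccentricity over all vertices. -/
noncomputable def graphDiam {V : Type*} [Fintype V] (G : SimpleGraph V) : ℕ :=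
  Finset.univ.sup (graphEcc G)

/-- A connected graph of order `n` is almost self-centered if it has exactly `n - 2`
central vertices (vertices whose eccentricity equals the radius). -/
def IsAlmostSelfCentered {V : Type*} [Fintype V] (G : SimpleGraph V) : Prop :=
  G.Connected ∧ Nat.card {v : V | graphEcc G v = graphRadius G} = Fintype.card V - 2

/-- A connected graph of order `n` is almost peripheral if it has exactly `n - 1`
peripheral vertices (vertices whose eccentricity equals the diameter). -/
def IsAlmostPeripheral {V : Type*} [Fintype V] (G : SimpleGraph V) : Prop :=
  G.Connected ∧ Nat.card {v : V | graphEcc G v = graphDiam G} = Fintype.card V - 1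

/-- A graph is `k`-regular if every vertex has degree `k`. -/
def IsKRegular {V : Type*} (G : SimpleGraph V) (k : ℕ) : Prop :=
  ∀ v : V, (G.neighborSet v).ncard = k

set_option synthInstance.maxSize 100000 in
set_option synthInstance.maxHeartbeats 1000000 in
lemma bool_r2_n8 : ∀ p12 p13 m11 m12 m13 : Bool,
    p12.toNat + p13.toNat + m11.toNat + m12.toNat + m13.toNat = 2 →
    ∀ p23 m21 m22 m23 : Bool,
    p12.toNat + p23.toNat + m21.toNat + m22.toNat + m23.toNat = 2 →
    ∀ m31 m32 m33 : Bool,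
    p13.toNat + p23.toNat + m31.toNat + m32.toNat + m33.toNat = 2 →
    (m11 || m12 || m13) → (m21 || m22 || m23) → (m31 || m32 || m33) →
    ∀ q12 q13 q23 : Bool,
    m11.toNat + m21.toNat + m31.toNat + q12.toNat + q13.toNat = 2 →
    m12.toNat + m22.toNat + m32.toNat + q12.toNat + q23.toNat = 2 →
    m13.toNat + m23.toNat + m33.toNat + q13.toNat + q23.toNat = 2 →
    (m11 || p12 && m21 || p13 && m31 || m12 && q12 || m13 && q13) →
    (m12 || p12 && m22 || p13 && m32 || m11 && q12 || m13 && q23) →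
    (m13 || p12 && m23 || p13 && m33 || m11 && q13 || m12 && q23) →
    (m21 || p12 && m11 || p23 && m31 || m22 && q12 || m23 && q13) →
    (m22 || p12 && m12 || p23 && m32 || m21 && q12 || m23 && q23) →
    (m23 || p12 && m13 || p23 && m33 || m21 && q13 || m22 && q23) →
    (m31 || p13 && m11 || p23 && m21 || m32 && q12 || m33 && q13) →
    (m32 || p13 && m12 || p23 && m22 || m31 && q12 || m33 && q23) →
    (m33 || p13 && m13 || p23 && m23 || m31 && q13 || m32 && q23) → False := by
  set_option maxRecDepth 100000 in
  decide +kernel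


section helpers
open Classical

lemma cubic_nbrs {V : Type*} [Fintype V] (G : SimpleGraph V) (hreg : IsKRegular G 3) (v : V) :
    ∃ a b c, a ≠ b ∧ a ≠ c ∧ b ≠ c ∧ ∀ u, G.Adj v u ↔ (u = a ∨ u = b ∨ u = c) := by
  obtain ⟨a, b, c, h1, h2, h3, h⟩ := Set.ncard_eq_three.mp (hreg v)
  refine ⟨a, b, c, h1, h2, h3, fun u => ?_⟩
  have : u ∈ G.neighborSet v ↔ u ∈ ({a, b, c} : Set V) := by rw [h]
  simpa using this

lemma cubic_card {V : Type*} [Fintype V] (G : SimpleGraph V) (hreg : IsKRegular G 3) (v : V) :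
    (G.neighborFinset v).card = 3 := by
  rw [← hreg v, Set.ncard_eq_toFinset_card']
  congr 1

lemma dist_le_graphEcc {V : Type*} [Fintype V] (G : SimpleGraph V) (u v : V) :
    G.dist u v ≤ graphEcc G u :=
  Finset.le_sup (f := fun w => G.dist u w) (Finset.mem_univ v)

lemma exists_dist_eq_graphEcc {V : Type*} [Fintype V] (G : SimpleGraph V) (u : V) :
    ∃ v, G.dist u v = graphEcc G u := by
  obtain ⟨v, -, hv⟩ := Finset.exists_mem_eq_sup (Finset.univ : Finset V) ⟨u, Finset.mem_univ u⟩
    (fun w => G.dist u w)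
  exact ⟨v, hv.symm⟩

lemma graphRadius_le {V : Type*} [Fintype V] (G : SimpleGraph V) (u : V) :
    graphRadius G ≤ graphEcc G u := Nat.sInf_le ⟨u, rfl⟩

lemma asc_struct {V : Type*} [Fintype V] (G : SimpleGraph V) (hreg : IsKRegular G 3)
    (hASC : IsAlmostSelfCentered G) :
    ∃ x y r, G.dist x y = r + 1 ∧
      ∀ u v, ¬(u = x ∧ v = y) → ¬(u = y ∧ v = x) → G.dist u v ≤ r := by
  obtain ⟨hc, hcard⟩ := hASC
  obtain ⟨v0⟩ := hc.nonempty
  have hn : 4 ≤ Fintype.card V := by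
    have h1 := cubic_card G hreg v0
    have h2 : (insert v0 (G.neighborFinset v0)).card = 4 := by
      rw [Finset.card_insert_of_notMem (by simp), h1]
    rw [← h2]; exact Finset.card_le_univ _
  set r := graphRadius G with hr
  have h2 : (Finset.univ.filter (fun v => ¬ graphEcc G v = r)).card = 2 := by
    have e := Finset.card_filter_add_card_filter_not (s := (Finset.univ : Finset V))
      (fun v => graphEcc G v = r)
    have e2 : (Finset.univ.filter (fun v => graphEcc G v = r)).card = Fintype.card V - 2 := by
      rw [← hcard, Nat.card_eq_fintype_card, Fintype.card_ofFinset]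
      congr 1
    rw [Finset.card_univ] at e
    omega
  obtain ⟨x, y, hxy, hS⟩ := Finset.card_eq_two.mp h2
  have hmem : ∀ v, graphEcc G v ≠ r ↔ (v = x ∨ v = y) := by
    intro v
    have : v ∈ Finset.univ.filter (fun v => ¬ graphEcc G v = r) ↔ v ∈ ({x, y} : Finset V) := by
      rw [hS]
    simpa using this
  have hle : ∀ u v, u ≠ x → u ≠ y → G.dist u v ≤ r := by
    intro u v h1 h2
    have := dist_le_graphEcc G u v
    have h3 : graphEcc G u = r := by
      by_contra h
      rcases (hmem u).1 h with h | h <;> contradiction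
    omega
  have hgt : r + 1 ≤ G.dist x y := by
    obtain ⟨z, hz⟩ := exists_dist_eq_graphEcc G x
    have h1 : graphEcc G x ≠ r := (hmem x).2 (Or.inl rfl)
    have h2 := graphRadius_le G x
    have h3 := dist_le_graphEcc G z x
    rw [SimpleGraph.dist_comm] at h3
    have h4 : graphEcc G z ≠ r := by omega
    rcases (hmem z).1 h4 with h | h
    · subst h
      rw [SimpleGraph.dist_self] at hz
      omega
    · subst h
      omega
  have hlt : G.dist x y ≤ r + 1 := by
    obtain ⟨a, b, c, hab, hac, hbc, hN⟩ := cubic_nbrs G hreg x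
    have : ∃ c, G.Adj x c ∧ c ≠ y := by
      by_cases h : a = y
      · exact ⟨b, (hN b).2 (by simp), by rintro rfl; exact hab h⟩
      · exact ⟨a, (hN a).2 (by simp), h⟩
    obtain ⟨c, h1, h2⟩ := this
    have h3 := hle c y h1.ne' h2
    have h4 := hc.dist_triangle (u := x) (v := c) (w := y)
    have h5 := SimpleGraph.dist_eq_one_iff_adj.2 h1
    omega
  refine ⟨x, y, r, le_antisymm hlt hgt, fun u v h1 h2 => ?_⟩
  by_cases hux : u ≠ x ∧ u ≠ y
  · exact hle u v hux.1 hux.2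
  by_cases hvx : v ≠ x ∧ v ≠ y
  · rw [SimpleGraph.dist_comm]; exact hle v u hvx.1 hvx.2
  have : u = v := by grind
  subst this
  simp

lemma dist_le_two_cases {V : Type*} (G : SimpleGraph V) (hc : G.Connected) {u v : V}
    (h : G.dist u v ≤ 2) : u = v ∨ G.Adj u v ∨ ∃ w, G.Adj u w ∧ G.Adj w v := by
  obtain ⟨p, hp⟩ := hc.exists_walk_length_eq_dist u v
  rw [← hp] at h
  match p, h with
  | .nil, _ => left; rfl
  | .cons h1 .nil, _ => right; left; exact h1
  | .cons h1 (.cons h2 .nil), _ => right; right; exact ⟨_, h1, h2⟩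
  | .cons h1 (.cons h2 (.cons h3 p)), h => simp at h

/-- predecessor on a geodesic -/
lemma exists_pred {V : Type*} (G : SimpleGraph V) (hc : G.Connected) {u v : V} {k : ℕ}
    (h : G.dist u v = k + 1) : ∃ w, G.Adj w v ∧ G.dist u w = k := by
  obtain ⟨p, hp⟩ := hc.exists_walk_length_eq_dist v u
  rw [SimpleGraph.dist_comm, h] at hp
  match p, hp with
  | .cons (v := w) h1 q, hp =>
    refine ⟨w, h1.symm, ?_⟩
    have h2 := SimpleGraph.dist_le q
    have h3 := hc.dist_triangle (u := u) (v := w) (w := v)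
    have h4 := SimpleGraph.dist_eq_one_iff_adj.2 h1.symm
    have h5 : G.dist u w = G.dist w u := SimpleGraph.dist_comm
    simp at hp
    omega

lemma card_even {V : Type*} [Fintype V] (G : SimpleGraph V) (hreg : IsKRegular G 3) :
    Even (Fintype.card V) := by
  have h := G.sum_degrees_eq_twice_card_edges
  have : ∀ v, G.degree v = 3 := fun v => cubic_card G hreg v
  simp [this] at h
  rw [Nat.even_iff]; omega

/-- In a cubic graph of order 10, a vertex of eccentricity at most two lies on no short cycle. -/
lemma no_short {V : Type*} [Fintype V] (G : SimpleGraph V) (hc : G.Connected)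
    (hreg : IsKRegular G 3) (hn : Fintype.card V = 10) (v : V) (hv : ∀ u, G.dist v u ≤ 2)
    (p q : V) (hp : G.Adj v p) (hq : G.Adj v q) (hpq : p ≠ q) :
    ¬ G.Adj p q ∧ ∀ z, G.Adj p z → G.Adj q z → z = v := by
  obtain ⟨s, hs⟩ : ∃ s, ∀ u, G.Adj v u → u = p ∨ u = q ∨ u = s := by
    obtain ⟨a, b, c, hab, hac, hbc, hN⟩ := cubic_nbrs G hreg v
    have h1 := (hN p).1 hp
    have h2 := (hN q).1 hq
    by_cases ha : a ≠ p ∧ a ≠ q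
    · exact ⟨a, by grind⟩
    by_cases hb : b ≠ p ∧ b ≠ q
    · exact ⟨b, by grind⟩
    exact ⟨c, by grind⟩
  have key : ∀ z, G.Adj q z → z ≠ v → (z = p ∨ G.Adj p z) → False := by
    intro z hz hzv hpz
    have hsub : (Finset.univ : Finset V) ⊆ ({v, p, q, s} : Finset V) ∪
        ((G.neighborFinset p).erase v ∪ (((G.neighborFinset q).erase v).erase z ∪
          (G.neighborFinset s).erase v)) := by
      intro u _
      simp only [Finset.mem_union, Finset.mem_insert, Finset.mem_singleton, Finset.mem_erase,
        SimpleGraph.mem_neighborFinset]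
      rcases dist_le_two_cases G hc (hv u) with h | h | ⟨w, h1, h2⟩
      · grind
      · have := hs u h; grind
      · have := hs w h1; grind
    have c1 : ((G.neighborFinset p).erase v).card = 2 := by
      rw [Finset.card_erase_of_mem (by simpa using hp.symm), cubic_card G hreg]
    have c2 : (((G.neighborFinset q).erase v).erase z).card = 1 := by
      rw [Finset.card_erase_of_mem (by simp [hz, hzv]),
        Finset.card_erase_of_mem (by simpa using hq.symm), cubic_card G hreg]
    have c4 : ({v, p, q, s} : Finset V).card ≤ 4 := Finset.card_le_four
    by_cases hvs : G.Adj v s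
    · have c3 : ((G.neighborFinset s).erase v).card = 2 := by
        rw [Finset.card_erase_of_mem (by simpa using hvs.symm), cubic_card G hreg]
      have := Finset.card_le_card hsub
      rw [Finset.card_univ, hn] at this
      have e1 := Finset.card_union_le ({v, p, q, s} : Finset V)
        ((G.neighborFinset p).erase v ∪ (((G.neighborFinset q).erase v).erase z ∪
          (G.neighborFinset s).erase v))
      have e2 := Finset.card_union_le ((G.neighborFinset p).erase v)
        (((G.neighborFinset q).erase v).erase z ∪ (G.neighborFinset s).erase v)
      have e3 := Finset.card_union_le (((G.neighborFinset q).erase v).erase z)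
        ((G.neighborFinset s).erase v)
      omega
    · exfalso
      have h3 := cubic_card G hreg v
      have : G.neighborFinset v ⊆ {p, q} := by
        intro u hu
        have hu : G.Adj v u := by simpa using hu
        have := hs u hu
        simp only [Finset.mem_insert, Finset.mem_singleton]
        grind
      have := Finset.card_le_card this
      have := Finset.card_le_two (a := p) (b := q)
      omega
  refine ⟨fun h => key p h.symm hp.ne' (Or.inl rfl), fun z h1 h2 => ?_⟩
  by_contra h
  exact key z h2 h (Or.inr h1)

lemma case_r2_n10 {V : Type*} [Fintype V] (G : SimpleGraph V) (hc : G.Connected)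
    (hreg : IsKRegular G 3) (hn : Fintype.card V = 10) (x y : V) (hxy : G.dist x y = 3)
    (hd : ∀ u v, ¬(u = x ∧ v = y) → ¬(u = y ∧ v = x) → G.dist u v ≤ 2) : False := by
  have hA : ∀ a, G.Adj x a → ¬ G.Adj a y ∧ a ≠ y := by
    intro a ha
    have h5 := SimpleGraph.dist_eq_one_iff_adj.2 ha
    refine ⟨fun h => ?_, ?_⟩
    · have h4 := hc.dist_triangle (u := x) (v := a) (w := y)
      have h6 := SimpleGraph.dist_eq_one_iff_adj.2 h
      omega
    · rintro rfl; omega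
  have hs : ∀ a, G.Adj x a → ∀ p q, G.Adj a p → G.Adj a q → p ≠ q →
      ¬ G.Adj p q ∧ ∀ z, G.Adj p z → G.Adj q z → z = a := by
    intro a ha p q
    have := ha.ne'
    have := hA a ha
    exact no_short G hc hreg hn a (fun u => hd a u (by grind) (by grind)) p q
  obtain ⟨a, b, c, hab, hac, hbc, hN⟩ := cubic_nbrs G hreg x
  have key : ∀ p q, G.Adj x p → G.Adj x q → p ≠ q → ¬ G.Adj p q ∧
      ∀ z, G.Adj p z → G.Adj q z → z = x := by
    intro p q hp hq hpq
    refine ⟨fun h => (hs p hp x q hp.symm h hq.ne).1 hq, fun z h1 h2 => ?_⟩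
    by_contra h
    exact hpq ((hs p hp x z hp.symm h1 (Ne.symm h)).2 q hq h2.symm).symm
  have ha := (hN a).2 (by simp)
  have hb := (hN b).2 (by simp)
  have hcc := (hN c).2 (by simp)
  have kab := key a b ha hb hab
  have kac := key a c ha hcc hac
  have kbc := key b c hb hcc hbc
  have ca : ∀ a, G.Adj x a → ((G.neighborFinset a).erase x).card = 2 := by
    intro a ha
    rw [Finset.card_erase_of_mem (by simpa using ha.symm), cubic_card G hreg]
  have c0 : (insert y (insert x (G.neighborFinset x))).card = 5 := by
    rw [Finset.card_insert_of_notMem, Finset.card_insert_of_notMem, cubic_card G hreg]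
    · simp
    · have := hA
      simp only [Finset.mem_insert, SimpleGraph.mem_neighborFinset]
      rintro (rfl | h)
      · simp at hxy
      · exact (hA y h).2 rfl
  have d1 : Disjoint ((G.neighborFinset a).erase x) ((G.neighborFinset b).erase x) := by
    rw [Finset.disjoint_left]; intro u; simp; grind
  have d2 : Disjoint ((G.neighborFinset a).erase x ∪ (G.neighborFinset b).erase x)
      ((G.neighborFinset c).erase x) := by
    rw [Finset.disjoint_left]; intro u; simp; grind
  have d3 : Disjoint (insert y (insert x (G.neighborFinset x)))
      (((G.neighborFinset a).erase x ∪ (G.neighborFinset b).erase x) ∪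
      ((G.neighborFinset c).erase x)) := by
    have h1 := hA a ha
    have h2 := hA b hb
    have h3 := hA c hcc
    have h4 := G.adj_comm
    rw [Finset.disjoint_left]; intro u
    have h5 := G.loopless.irrefl u
    simp only [Finset.mem_insert, SimpleGraph.mem_neighborFinset, Finset.mem_union,
      Finset.mem_erase, hN]
    grind
  have := Finset.card_le_univ ((insert y (insert x (G.neighborFinset x))) ∪
      (((G.neighborFinset a).erase x ∪ (G.neighborFinset b).erase x) ∪
      ((G.neighborFinset c).erase x)))
  rw [Finset.card_union_of_disjoint d3, Finset.card_union_of_disjoint d2,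
    Finset.card_union_of_disjoint d1, c0, ca a ha, ca b hb, ca c hcc] at this
  omega


set_option maxHeartbeats 1000000 in
set_option linter.unusedSimpArgs false in
lemma case_r2_n8 {V : Type*} [Fintype V] (G : SimpleGraph V) (hc : G.Connected)
    (hreg : IsKRegular G 3) (hn : Fintype.card V = 8) (x y : V) (hxy : G.dist x y = 3)
    (hd : ∀ u v, ¬(u = x ∧ v = y) → ¬(u = y ∧ v = x) → G.dist u v ≤ 2) : False := by
  obtain ⟨a, b, c, hab, hac, hbc, hN⟩ := cubic_nbrs G hreg x
  obtain ⟨d, e, f, hde, hdf, hef, hM⟩ := cubic_nbrs G hreg y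
  have hx1 : x ≠ y := by rintro rfl; simp at hxy
  have hx2 : ¬ G.Adj x y := by
    intro h; rw [SimpleGraph.dist_eq_one_iff_adj.2 h] at hxy; omega
  have hx3 : ∀ w, G.Adj x w → ¬ G.Adj y w := by
    intro w h1 h2
    have h3 := hc.dist_triangle (u := x) (v := w) (w := y)
    have h4 := SimpleGraph.dist_eq_one_iff_adj.2 h1
    have h5 := SimpleGraph.dist_eq_one_iff_adj.2 h2.symm
    omega
  have hirr : ∀ u, ¬ G.Adj u u := fun u => G.loopless.irrefl u
  have sym : ∀ u v, G.Adj u v ↔ G.Adj v u := fun u v => G.adj_comm u v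
  have xx := hirr x
  have yy := hirr y
  have hx2' := hx2
  rw [sym] at hx2'
  simp only [hN, hM, not_or] at xx yy hx2 hx2' hx3
  obtain ⟨xa, xb, xc⟩ := xx
  obtain ⟨yd, ye, yf⟩ := yy
  obtain ⟨ya, yb, yc⟩ := hx2
  obtain ⟨xd, xe, xf⟩ := hx2'
  obtain ⟨ad, ae, af⟩ := hx3 a (by simp)
  obtain ⟨bd, be, bf⟩ := hx3 b (by simp)
  obtain ⟨cd, ce, cf⟩ := hx3 c (by simp)
  have huniv : (Finset.univ : Finset V) = {x, y, a, b, c, d, e, f} := by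
    symm
    apply Finset.eq_univ_of_card
    rw [hn]
    repeat rw [Finset.card_insert_of_notMem (by simp [*])]
    simp
  have deg : ∀ v, ∑ u, (decide (G.Adj v u)).toNat = 3 := by
    intro v
    rw [← cubic_card G hreg v, SimpleGraph.neighborFinset_eq_filter, Finset.card_filter]
    apply Finset.sum_congr rfl
    intro u _
    by_cases h : G.Adj v u <;> simp [h]
  have deg' : ∀ v, (decide (G.Adj v x)).toNat + ((decide (G.Adj v y)).toNat +
      ((decide (G.Adj v a)).toNat + ((decide (G.Adj v b)).toNat + ((decide (G.Adj v c)).toNat +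
      ((decide (G.Adj v d)).toNat + ((decide (G.Adj v e)).toNat +
      (decide (G.Adj v f)).toNat)))))) = 3 := by
    intro v
    have := deg v
    rw [huniv] at this
    repeat rw [Finset.sum_insert (by simp [*])] at this
    simpa using this
  have hall : ∀ w, w = x ∨ w = y ∨ w = a ∨ w = b ∨ w = c ∨ w = d ∨ w = e ∨ w = f := by
    intro w
    have := Finset.mem_univ w
    rw [huniv] at this
    simpa using this
  have ax : ∀ u, G.Adj u x ↔ u = a ∨ u = b ∨ u = c := fun u => by rw [sym, hN]
  have ay : ∀ u, G.Adj u y ↔ u = d ∨ u = e ∨ u = f := fun u => by rw [sym, hM]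
  have ba := sym b a
  have ca := sym c a
  have cb := sym c b
  have ed := sym e d
  have fd := sym f d
  have fe := sym f e
  have da := sym d a
  have db := sym d b
  have dc := sym d c
  have ea := sym e a
  have eb := sym e b
  have ec := sym e c
  have fa := sym f a
  have fb := sym f b
  have fc := sym f c
  have dist2 : ∀ u v, u ≠ v → u ≠ x → u ≠ y → G.Adj u v ∨ (G.Adj u x ∧ G.Adj x v) ∨
      (G.Adj u y ∧ G.Adj y v) ∨ (G.Adj u a ∧ G.Adj a v) ∨ (G.Adj u b ∧ G.Adj b v) ∨
      (G.Adj u c ∧ G.Adj c v) ∨ (G.Adj u d ∧ G.Adj d v) ∨ (G.Adj u e ∧ G.Adj e v) ∨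
      (G.Adj u f ∧ G.Adj f v) := by
    intro u v h h1 h2
    rcases dist_le_two_cases G hc (hd u v (fun h' => h1 h'.1) (fun h' => h2 h'.1)) with h | h | ⟨w, h⟩
    · contradiction
    · exact Or.inl h
    · rcases hall w with rfl | rfl | rfl | rfl | rfl | rfl | rfl | rfl <;> simp only [h, true_and, and_self, true_or, or_true]
  have Da := deg' a
  have Db := deg' b
  have Dc := deg' c
  have Dd := deg' d
  have De := deg' e
  have Df := deg' f
  have Aay := dist2 a y (Ne.symm ya) (Ne.symm xa) (Ne.symm ya)
  have Aby := dist2 b y (Ne.symm yb) (Ne.symm xb) (Ne.symm yb)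
  have Acy := dist2 c y (Ne.symm yc) (Ne.symm xc) (Ne.symm yc)
  have Aad := dist2 a d ad (Ne.symm xa) (Ne.symm ya)
  have Aae := dist2 a e ae (Ne.symm xa) (Ne.symm ya)
  have Aaf := dist2 a f af (Ne.symm xa) (Ne.symm ya)
  have Abd := dist2 b d bd (Ne.symm xb) (Ne.symm yb)
  have Abe := dist2 b e be (Ne.symm xb) (Ne.symm yb)
  have Abf := dist2 b f bf (Ne.symm xb) (Ne.symm yb)
  have Acd := dist2 c d cd (Ne.symm xc) (Ne.symm yc)
  have Ace := dist2 c e ce (Ne.symm xc) (Ne.symm yc)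
  have Acf := dist2 c f cf (Ne.symm xc) (Ne.symm yc)
  have ad' := Ne.symm ad
  have ae' := Ne.symm ae
  have af' := Ne.symm af
  have bd' := Ne.symm bd
  have be' := Ne.symm be
  have bf' := Ne.symm bf
  have cd' := Ne.symm cd
  have ce' := Ne.symm ce
  have cf' := Ne.symm cf
  have ya' := Ne.symm ya
  have yb' := Ne.symm yb
  have yc' := Ne.symm yc
  have xd' := Ne.symm xd
  have xe' := Ne.symm xe
  have xf' := Ne.symm xf
  simp only [ax, ay, hN, hM, hirr, ba, ca, cb, ed, fd, fe, da, db, dc, ea, eb, ec, fa, fb, fc,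
    ad, ae, af, bd, be, bf, cd, ce, cf, ad', ae', af', bd', be', bf', cd', ce', cf', ya, yb, yc,
    xd, xe, xf, ya', yb', yc', xd', xe', xf', or_true, true_or, or_false, false_or, and_true,
    true_and, and_false, false_and, decide_true, decide_false, Bool.toNat_true, Bool.toNat_false]
    at Da Db Dc Dd De Df Aay Aby Acy Aad Aae Aaf Abd Abe Abf Acd Ace Acf
  refine bool_r2_n8 (decide (G.Adj a b)) (decide (G.Adj a c)) (decide (G.Adj a d))
    (decide (G.Adj a e)) (decide (G.Adj a f)) ?_ (decide (G.Adj b c)) (decide (G.Adj b d))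
    (decide (G.Adj b e)) (decide (G.Adj b f)) ?_ (decide (G.Adj c d))
    (decide (G.Adj c e)) (decide (G.Adj c f)) ?_ ?_ ?_ ?_ (decide (G.Adj d e))
    (decide (G.Adj d f)) (decide (G.Adj e f)) ?_ ?_ ?_ ?_ ?_ ?_ ?_ ?_ ?_ ?_ ?_ ?_
  · clear * - Da; omega
  · clear * - Db; omega
  · clear * - Dc; omega
  · simpa only [Bool.or_eq_true, Bool.and_eq_true, decide_eq_true_eq, or_assoc] using Aay
  · simpa only [Bool.or_eq_true, Bool.and_eq_true, decide_eq_true_eq, or_assoc] using Aby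
  · simpa only [Bool.or_eq_true, Bool.and_eq_true, decide_eq_true_eq, or_assoc] using Acy
  · clear * - Dd; omega
  · clear * - De; omega
  · clear * - Df; omega
  · simpa only [Bool.or_eq_true, Bool.and_eq_true, decide_eq_true_eq, or_assoc] using Aad
  · simpa only [Bool.or_eq_true, Bool.and_eq_true, decide_eq_true_eq, or_assoc] using Aae
  · simpa only [Bool.or_eq_true, Bool.and_eq_true, decide_eq_true_eq, or_assoc] using Aaf
  · simpa only [Bool.or_eq_true, Bool.and_eq_true, decide_eq_true_eq, or_assoc] using Abd
  · simpa only [Bool.or_eq_true, Bool.and_eq_true, decide_eq_true_eq, or_assoc] using Abe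
  · simpa only [Bool.or_eq_true, Bool.and_eq_true, decide_eq_true_eq, or_assoc] using Abf
  · simpa only [Bool.or_eq_true, Bool.and_eq_true, decide_eq_true_eq, or_assoc] using Acd
  · simpa only [Bool.or_eq_true, Bool.and_eq_true, decide_eq_true_eq, or_assoc] using Ace
  · simpa only [Bool.or_eq_true, Bool.and_eq_true, decide_eq_true_eq, or_assoc] using Acf

lemma exists_mid {V : Type*} (G : SimpleGraph V) (hc : G.Connected) (u : V) (i j : ℕ) :
    ∀ v, G.dist u v = i + j → ∃ w, G.dist u w = i ∧ G.dist w v = j := by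
  induction j with
  | zero => intro v h; exact ⟨v, by simpa using h, by simp⟩
  | succ j ih =>
    intro v h
    obtain ⟨v', h1, h2⟩ := exists_pred G hc (k := i + j) (by omega)
    obtain ⟨w, h3, h4⟩ := ih v' h2
    refine ⟨w, h3, ?_⟩
    have h5 := hc.dist_triangle (u := w) (v := v') (w := v)
    have h6 := hc.dist_triangle (u := u) (v := w) (w := v)
    have h7 := SimpleGraph.dist_eq_one_iff_adj.2 h1
    omega

/-- The vertices outside both closed neighbourhoods. -/
lemma card_outside {V : Type*} [Fintype V] (G : SimpleGraph V) (hc : G.Connected)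
    (hreg : IsKRegular G 3) (x y : V) (hxy : 3 ≤ G.dist x y) :
    (Finset.univ.filter (fun w => 2 ≤ G.dist x w ∧ 2 ≤ G.dist w y)).card + 8 ≤
      Fintype.card V := by
  have cx : ∀ x, (insert x (G.neighborFinset x)).card = 4 := by
    intro x
    rw [Finset.card_insert_of_notMem (by simp), cubic_card G hreg]
  have hX : ∀ x u, u ∈ insert x (G.neighborFinset x) → G.dist x u ≤ 1 := by
    intro x u hu
    simp only [Finset.mem_insert, SimpleGraph.mem_neighborFinset] at hu
    rcases hu with rfl | h
    · simp
    · exact (SimpleGraph.dist_eq_one_iff_adj.2 h).le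
  have d1 : Disjoint (insert x (G.neighborFinset x)) (insert y (G.neighborFinset y)) := by
    rw [Finset.disjoint_left]
    intro u h1 h2
    have h1 := hX x u h1
    have h2 := hX y u h2
    rw [SimpleGraph.dist_comm] at h2
    have h5 := hc.dist_triangle (u := x) (v := u) (w := y)
    omega
  have d2 : Disjoint (Finset.univ.filter (fun w => 2 ≤ G.dist x w ∧ 2 ≤ G.dist w y))
      (insert x (G.neighborFinset x) ∪ insert y (G.neighborFinset y)) := by
    rw [Finset.disjoint_left]
    intro u h1 h2
    have h1 := (Finset.mem_filter.1 h1).2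
    rcases Finset.mem_union.1 h2 with h2 | h2
    · have h2 := hX x u h2
      omega
    · have h2 := hX y u h2
      rw [SimpleGraph.dist_comm] at h2
      omega
  have := Finset.card_le_univ (Finset.univ.filter (fun w => 2 ≤ G.dist x w ∧ 2 ≤ G.dist w y) ∪
    (insert x (G.neighborFinset x) ∪ insert y (G.neighborFinset y)))
  rw [Finset.card_union_of_disjoint d2, Finset.card_union_of_disjoint d1, cx, cx] at this
  omega

lemma case_r_ge4 {V : Type*} [Fintype V] (G : SimpleGraph V) (hc : G.Connected)
    (hreg : IsKRegular G 3) (hn : Fintype.card V ≤ 10) (x y : V) (r : ℕ) (hr : 4 ≤ r)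
    (hxy : G.dist x y = r + 1)
    (hd : ∀ u v, ¬(u = x ∧ v = y) → ¬(u = y ∧ v = x) → G.dist u v ≤ r) : False := by
  have hW := card_outside G hc hreg x y (by omega)
  set W := Finset.univ.filter (fun w => 2 ≤ G.dist x w ∧ 2 ≤ G.dist w y) with hWd
  have mem : ∀ w, w ∈ W ↔ 2 ≤ G.dist x w ∧ 2 ≤ G.dist w y := by simp [hWd]
  obtain ⟨w3, h3, h3'⟩ := exists_mid G hc x 3 (r - 2) y (by omega)
  obtain ⟨w2, h23, h2⟩ := exists_pred G hc (k := 2) h3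
  have h2' := hc.dist_triangle (u := x) (v := w2) (w := y)
  have hne : w2 ≠ w3 := h23.ne
  have m3 : w3 ∈ W := (mem _).2 (by omega)
  have m2 : w2 ∈ W := (mem _).2 (by omega)
  have only : ∀ w ∈ W, w = w2 ∨ w = w3 := by
    intro w hw
    by_contra h
    push Not at h
    have hs : ({w, w2, w3} : Finset V) ⊆ W := by
      intro u; simp only [Finset.mem_insert, Finset.mem_singleton]; rintro (rfl | rfl | rfl) <;>
        assumption
    have := Finset.card_le_card hs
    rw [Finset.card_eq_three.2 ⟨w, w2, w3, h.1, h.2, hne, rfl⟩] at this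
    omega
  have hr4 : r = 4 := by
    by_contra h
    obtain ⟨w4, h4, h4'⟩ := exists_mid G hc x 4 (r - 3) y (by omega)
    rcases only w4 ((mem _).2 (by omega)) with rfl | rfl <;> omega
  subst hr4
  have hb : ∀ b, G.Adj y b → G.Adj w3 b := by
    intro b hb
    have b1 := SimpleGraph.dist_eq_one_iff_adj.2 hb.symm
    have b2 := hc.dist_triangle (u := x) (v := b) (w := y)
    have b3 := hd x b (fun h => hb.ne h.2.symm) (by rintro ⟨rfl, -⟩; simp at hxy)
    obtain ⟨w, p1, p2⟩ := exists_pred G hc (u := x) (v := b) (k := 3) (by omega)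
    have b4 := hc.dist_triangle (u := x) (v := w) (w := y)
    rcases only w ((mem _).2 (by omega)) with rfl | rfl
    · omega
    · exact p1
  have hs : insert w2 (G.neighborFinset y) ⊆ G.neighborFinset w3 := by
    intro u
    simp only [Finset.mem_insert, SimpleGraph.mem_neighborFinset]
    rintro (rfl | h)
    · exact h23.symm
    · exact hb u h
  have := Finset.card_le_card hs
  rw [Finset.card_insert_of_notMem, cubic_card G hreg, cubic_card G hreg] at this
  · omega
  · intro h
    have h := SimpleGraph.dist_eq_one_iff_adj.2 ((SimpleGraph.mem_neighborFinset _ _ _).1 h).symm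
    omega

lemma case_r3 {V : Type*} [Fintype V] (G : SimpleGraph V) (hc : G.Connected)
    (hreg : IsKRegular G 3) (hn : Fintype.card V ≤ 10) (x y : V)
    (hxy : G.dist x y = 4)
    (hd : ∀ u v, ¬(u = x ∧ v = y) → ¬(u = y ∧ v = x) → G.dist u v ≤ 3) : False := by
  have hW := card_outside G hc hreg x y (by omega)
  set W := Finset.univ.filter (fun w => 2 ≤ G.dist x w ∧ 2 ≤ G.dist w y) with hWd
  have mem : ∀ w, w ∈ W ↔ 2 ≤ G.dist x w ∧ 2 ≤ G.dist w y := by simp [hWd]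
  have hxne : x ≠ y := by rintro rfl; simp at hxy
  obtain ⟨w1, w2, m1, m2, only⟩ : ∃ w1 w2, w1 ∈ W ∧ w2 ∈ W ∧ ∀ w ∈ W, w = w1 ∨ w = w2 := by
    have : W.card ≤ 2 := by omega
    obtain ⟨w, h1, h2⟩ := exists_mid G hc x 2 2 y (by omega)
    have hw : w ∈ W := (mem _).2 (by omega)
    have hpos := Finset.card_pos.2 ⟨w, hw⟩
    interval_cases h : W.card
    · obtain ⟨w, hw⟩ := Finset.card_eq_one.1 h
      exact ⟨w, w, by simp [hw]⟩
    · obtain ⟨w, w', -, hw⟩ := Finset.card_eq_two.1 h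
      exact ⟨w, w', by simp [hw]⟩
  have tri := fun w => hc.dist_triangle (u := x) (v := w) (w := y)
  have one : ∀ {u v}, G.Adj u v → G.dist u v = 1 := fun h => SimpleGraph.dist_eq_one_iff_adj.2 h
  have hb : ∀ b, G.Adj y b → G.Adj b w1 ∨ G.Adj b w2 := by
    intro b hb
    have b1 := one hb.symm
    have b2 := tri b
    have b3 := hd x b (fun h => hb.ne h.2.symm) (fun h => hxne h.1)
    obtain ⟨w, p1, p2⟩ := exists_pred G hc (u := x) (v := b) (k := 2) (by omega)
    have b4 := tri w
    rcases only w ((mem _).2 (by omega)) with rfl | rfl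
    · exact Or.inl p1.symm
    · exact Or.inr p1.symm
  have ha : ∀ a, G.Adj x a → G.Adj a w1 ∨ G.Adj a w2 := by
    intro a ha
    have b1 := one ha
    have b2 := tri a
    have b3 := hd y a (fun h => hxne h.1.symm) (fun h => ha.ne h.2.symm)
    rw [SimpleGraph.dist_comm] at b3
    obtain ⟨w, p1, p2⟩ := exists_pred G hc (u := y) (v := a) (k := 2)
      (by rw [SimpleGraph.dist_comm]; omega)
    rw [SimpleGraph.dist_comm] at p2
    have b4 := tri w
    rcases only w ((mem _).2 (by omega)) with rfl | rfl
    · exact Or.inl p1.symm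
    · exact Or.inr p1.symm
  have dAB : Disjoint (G.neighborFinset x) (G.neighborFinset y) := by
    rw [Finset.disjoint_left]
    intro u h1 h2
    have h1 := one ((SimpleGraph.mem_neighborFinset _ _ _).1 h1)
    have h2 := one ((SimpleGraph.mem_neighborFinset _ _ _).1 h2).symm
    have := tri u
    omega
  have cov : ∀ z, (∀ a, G.Adj z a → G.Adj a w1 ∨ G.Adj a w2) →
      G.neighborFinset z = (G.neighborFinset w1 ∩ G.neighborFinset z) ∪
        (G.neighborFinset w2 ∩ G.neighborFinset z) := by
    intro z hz
    ext u
    have := hz u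
    simp only [Finset.mem_union, Finset.mem_inter, SimpleGraph.mem_neighborFinset,
      G.adj_comm w1, G.adj_comm w2]
    tauto
  have cA := congrArg Finset.card (cov x ha)
  have cB := congrArg Finset.card (cov y hb)
  have iA := Finset.card_union_add_card_inter (G.neighborFinset w1 ∩ G.neighborFinset x)
        (G.neighborFinset w2 ∩ G.neighborFinset x)
  have iB := Finset.card_union_add_card_inter (G.neighborFinset w1 ∩ G.neighborFinset y)
        (G.neighborFinset w2 ∩ G.neighborFinset y)
  rw [← cA] at iA
  rw [← cB] at iB
  rw [cubic_card G hreg] at iA iB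
  have le3 : ∀ w, (G.neighborFinset w ∩ G.neighborFinset x).card +
      (G.neighborFinset w ∩ G.neighborFinset y).card ≤ 3 := by
    intro w
    rw [← Finset.card_union_of_disjoint (dAB.mono Finset.inter_subset_right
      Finset.inter_subset_right), ← cubic_card G hreg w]
    exact Finset.card_le_card (Finset.union_subset Finset.inter_subset_left
      Finset.inter_subset_left)
  have l1 := le3 w1
  have l2 := le3 w2
  have hemp : ((G.neighborFinset w1 ∩ G.neighborFinset x) ∩
        (G.neighborFinset w2 ∩ G.neighborFinset x)).card = 0 := by omega
  rw [Finset.card_eq_zero] at hemp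
  have hnot : ∀ a, G.Adj x a → ¬ (G.Adj a w1 ∧ G.Adj a w2) := by
    intro a h1 ⟨h2, h3⟩
    have : a ∈ ((G.neighborFinset w1 ∩ G.neighborFinset x) ∩
        (G.neighborFinset w2 ∩ G.neighborFinset x)) := by
      simp [h1, h2.symm, h3.symm]
    rw [hemp] at this
    simp at this
  have nbr : ∀ a, G.Adj x a → ∀ u, G.Adj a u → u = x ∨ G.Adj x u ∨ u = w1 ∨ u = w2 := by
    intro a h1 u h2
    by_cases h3 : u = x
    · exact Or.inl h3
    by_cases h4 : G.Adj x u
    · exact Or.inr (Or.inl h4)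
    right; right
    apply only
    rw [mem]
    have e1 := one h1
    have e2 := one h2
    have e3 := tri u
    have e4 := hc.dist_triangle (u := x) (v := a) (w := u)
    have e5 : G.dist x u ≠ 1 := fun h => h4 (SimpleGraph.dist_eq_one_iff_adj.1 h)
    have e6 : G.dist x u ≠ 0 := fun h => h3 ((hc.dist_eq_zero_iff.1 h).symm)
    omega
  have far : ∀ w ∈ W, w ≠ x ∧ ¬ G.Adj x w := by
    intro w hw
    have h := ((mem w).1 hw).1
    refine ⟨?_, fun h' => ?_⟩
    · rintro rfl; simp at h
    · rw [one h'] at h; omega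
  obtain ⟨a, b, c, hab, hac, hbc, hN⟩ := cubic_nbrs G hreg x
  have key : ∀ a b c, a ≠ b → a ≠ c → b ≠ c → (∀ u, G.Adj x u ↔ (u = a ∨ u = b ∨ u = c)) →
      (G.Adj a b ↔ ¬ G.Adj a c) := by
    intro a b c hab hac hbc hN
    have hxa := (hN a).2 (by simp)
    have hxb := (hN b).2 (by simp)
    have hxc := (hN c).2 (by simp)
    have n1 := ha a hxa
    have n2 := hnot a hxa
    have n3 := nbr a hxa
    have nxx := G.loopless.irrefl a
    have W1 := far w1 m1
    have W2 := far w2 m2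
    obtain ⟨p, q, s, hpq, hps, hqs, hM⟩ := cubic_nbrs G hreg a
    have hax := hxa.symm
    clear ha hb hnot nbr cA cB iA iB l1 l2 le3 hemp cov dAB only tri one
    have ap := (hM p).2 (by simp)
    have aq := (hM q).2 (by simp)
    have as := (hM s).2 (by simp)
    have np := n3 p ap
    have nq := n3 q aq
    have ns := n3 s as
    have xb := hxb.ne
    have xc := hxc.ne
    have xa := hxa.ne
    simp only [hN, not_or] at np nq ns W1 W2
    have pa : p ≠ a := ap.ne'
    have qa : q ≠ a := aq.ne'
    have sa : s ≠ a := as.ne'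
    simp only [hM] at n1 n2 hax ⊢
    clear far m1 m2 hW hd hxy hn hc hreg hxne n3 hN hM mem hWd ap aq as hxa hxb hxc
    clear W
    grind
  have k1 := key a b c hab hac hbc hN
  have k2 := key b a c hab.symm hbc hac (by grind)
  have k3 := key c a b hac.symm hbc.symm hab (by grind)
  have := G.adj_comm a b
  have := G.adj_comm a c
  have := G.adj_comm b c
  tauto

end helpers

theorem order_ge_twelve_of_cubic_almostSelfCentered {V : Type*} [Fintype V]
    (G : SimpleGraph V) (hreg : IsKRegular G 3) (hASC : IsAlmostSelfCentered G) :
    12 ≤ Fintype.card V := by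
  classical
  by_contra hlt
  have hev := card_even G hreg
  rw [Nat.even_iff] at hev
  obtain ⟨x, y, r, hxy, hd⟩ := asc_struct G hreg hASC
  have hc := hASC.1
  have hxne : x ≠ y := by rintro rfl; simp at hxy
  by_cases h4 : 4 ≤ r
  · exact case_r_ge4 G hc hreg (by omega) x y r h4 hxy hd
  by_cases h3 : r = 3
  · subst h3; exact case_r3 G hc hreg (by omega) x y hxy hd
  by_cases h2 : r = 2
  · subst h2
    have h8 := card_outside G hc hreg x y (by omega)
    by_cases h10 : Fintype.card V = 10
    · exact case_r2_n10 G hc hreg h10 x y hxy hd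
    · exact case_r2_n8 G hc hreg (by omega) x y hxy hd
  obtain ⟨a, b, c, hab, hac, hbc, hN⟩ := cubic_nbrs G hreg x
  obtain ⟨a, ha, hay⟩ : ∃ c, G.Adj x c ∧ c ≠ y := by
    by_cases h : a = y
    · exact ⟨b, (hN b).2 (by simp), by rintro rfl; exact hab h⟩
    · exact ⟨a, (hN a).2 (by simp), h⟩
  have e1 := SimpleGraph.dist_eq_one_iff_adj.2 ha
  have e2 := hd x a (fun h => hay h.2) (fun h => hxne h.1)
  have h1 : r = 1 := by omega
  subst h1
  have c1 : (insert a (G.neighborFinset a)).card = 4 := by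
    rw [Finset.card_insert_of_notMem (by simp), cubic_card G hreg]
  have hu : (Finset.univ : Finset V) ⊆ insert a (G.neighborFinset a) := by
    intro u _
    simp only [Finset.mem_insert, SimpleGraph.mem_neighborFinset]
    have e3 := hd a u (fun h => ha.ne h.1.symm) (fun h => hay h.1)
    by_cases h : u = a
    · exact Or.inl h
    · right
      apply SimpleGraph.dist_eq_one_iff_adj.1
      have : G.dist a u ≠ 0 := fun h' => h (hc.dist_eq_zero_iff.1 h').symm
      omega
  have hu := Finset.card_le_card hu
  have c2 : (insert y (insert x (G.neighborFinset x))).card = 5 := by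
    rw [Finset.card_insert_of_notMem, Finset.card_insert_of_notMem (by simp), cubic_card G hreg]
    simp only [Finset.mem_insert, SimpleGraph.mem_neighborFinset, not_or]
    refine ⟨Ne.symm hxne, fun h => ?_⟩
    rw [SimpleGraph.dist_eq_one_iff_adj.2 h] at hxy
    omega
  have := Finset.card_le_univ (insert y (insert x (G.neighborFinset x)))
  rw [Finset.card_univ] at hu
  omega
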